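/- arXiv:2504.17962 — 3 statements merged into one kernel-verified Lean document; each statement's English description precedes it below -/
import Mathlib

section
/- Let G be a finite group, K/ℚ a finite Galois extension, and Θ ∈ B(G) a K-relation. Then in the decomposition of ℂ[G/Θ] into ℚ-irreducibles, ℂ[G/Θ] ≅ ⊕_{τ ∈ Irr_ℚ(G)} N_{ℚ(χ_τ)/ℚ}(χ_τ)^{⊕ k_τ}, each multiplicity k_τ is divisible by the degree [K : K ∩ ℚ(χ_τ)], where χ_τ is a complex irreducible constituent of τ and N_{ℚ(χ)/ℚ}(χ) = ⊕_{σ ∈ Gal(ℚ(χ)/ℚ)} χ^σ. -/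
open scoped BigOperators

/-- The number of fixed points of `g` acting on the coset space `G ⧸ H`
(the value at `g` of the character of the permutation representation `ℂ[G/H]`). -/
noncomputable def permFix {G : Type*} [Group G] (H : Subgroup G) (g : G) : ℕ :=
  Nat.card {x : G ⧸ H // g • x = x}

open Module IntermediateField

theorem exists_ringHom_comp_algebraMap_eq {R A B : Type*} [CommRing R] [IsDomain R] [Field A]
    [Field B] [IsAlgClosed B] [Algebra R A] [FaithfulSMul R A] [Algebra.IsAlgebraic R A]
    (f : R →+* B) (hf : Function.Injective f) : ∃ g : A →+* B, g.comp (algebraMap R A) = f := by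
  let := f.toAlgebra
  have : FaithfulSMul R B := (faithfulSMul_iff_algebraMap_injective R B).mpr hf
  let g : A →ₐ[R] B := IsAlgClosed.lift
  exact ⟨g.toRingHom, g.comp_algebraMap⟩

theorem IntermediateField.exists_ringHom_extending {k L : Type*} [Field k] [Field L] [IsAlgClosed L]
    [Algebra k L] (K : IntermediateField k L) (σ : K ≃ₐ[k] K) :
    ∃ τ : L →+* L, ∀ x : K, τ x = σ x := by
  obtain ⟨s, hs⟩ := exists_isTranscendenceBasis K L
  have := hs.isAlgebraic
  obtain ⟨τ, hτ⟩ := exists_ringHom_comp_algebraMap_eq (A := L)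
    (((MvPolynomial.aeval (R := K) ((↑) : s → L)).toRingHom.comp
      (MvPolynomial.map (σ : K →+* K))).comp hs.1.aevalEquiv.symm.toRingEquiv.toRingHom)
    (Function.Injective.comp (g := MvPolynomial.aeval (R := K) ((↑) : s → L)) hs.1
      ((MvPolynomial.map_injective _ σ.injective).comp
      hs.1.aevalEquiv.symm.injective))
  refine ⟨τ, fun x => ?_⟩
  have h := RingHom.congr_fun hτ (algebraMap K _ x)
  have h2 : hs.1.aevalEquiv.symm (algebraMap K _ x) = MvPolynomial.C x :=
    hs.1.aevalEquiv.symm.commutes x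
  simpa [h2] using h

theorem Subgroup.natCard_dvd_sum {Γ : Type*} [Group Γ] [Fintype Γ] (S : Subgroup Γ) (f : Γ → ℤ)
    (hf : ∀ s ∈ S, ∀ σ, f (s * σ) = f σ) : (Nat.card S : ℤ) ∣ ∑ σ, f σ := by
  classical
  have hinv (σ : Γ) : f σ = f (Quotient.out ((σ⁻¹ : Γ) : Γ ⧸ S))⁻¹ := by
    obtain ⟨s, hs⟩ := QuotientGroup.mk_out_eq_mul S σ⁻¹
    rw [hs, mul_inv_rev, inv_inv, hf _ (inv_mem s.2)]
  have e : ∑ σ, f σ = ∑ p : (Γ ⧸ S) × S, f (Quotient.out p.1)⁻¹ :=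
    Fintype.sum_equiv ((Equiv.inv Γ).trans S.groupEquivQuotientProdSubgroup) _ _ fun σ => hinv σ
  rw [e, Fintype.sum_prod_type]
  refine Finset.dvd_sum fun q _ => ?_
  simp [Nat.card_eq_fintype_card]

theorem FDRep.exists_int_average_char_mul_ringHom {G : Type} [Group G] [Fintype G]
    (τ : ℂ →+* ℂ) (X V : FDRep ℂ G) :
    ∃ n : ℤ, (Fintype.card G : ℂ)⁻¹ * ∑ g : G, X.character g⁻¹ * τ (V.character g) = n := by
  classical
  let b := Module.finBasis ℂ V
  let ρ : Representation ℂ G (Fin (finrank ℂ V) → ℂ) :=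
    (MonoidHomClass.toMonoidHom (Matrix.toLinAlgEquiv' (R := ℂ) (n := Fin (finrank ℂ V)))).comp
      ((MonoidHomClass.toMonoidHom (τ.mapMatrix (m := Fin (finrank ℂ V)))).comp
        ((MonoidHomClass.toMonoidHom (LinearMap.toMatrixAlgEquiv b)).comp V.ρ))
  have hρ : ∀ g, ρ.character g = τ (V.character g) := by
    intro g
    have : ρ g = Matrix.toLin' (τ.mapMatrix (LinearMap.toMatrix b b (V.ρ g))) := rfl
    rw [Representation.character, this, Matrix.trace_toLin'_eq, FDRep.character,
      LinearMap.trace_eq_matrix_trace ℂ b, AddMonoidHom.map_trace τ]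
    rfl
  have : Invertible (Nat.card G : ℂ) :=
    invertibleOfNonzero (Nat.cast_ne_zero.mpr Nat.card_pos.ne')
  refine ⟨finrank ℂ (Representation.IntertwiningMap X.ρ ρ), ?_⟩
  simp_rw [← hρ, mul_comm (X.character _), ← Nat.card_eq_fintype_card, Int.cast_natCast]
  exact Representation.card_inv_mul_sum_char_mul_char_eq_finrank X.ρ ρ

open scoped ComplexOrder in
theorem FDRep.conj_character {G : Type} [Group G] [Fintype G] (X : FDRep ℂ G) (g : G) :
    (starRingEnd ℂ) (X.character g) = X.character g⁻¹ := by
  classical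
  let b := Module.finBasis ℂ X
  let A : G →* Matrix (Fin (finrank ℂ X)) (Fin (finrank ℂ X)) ℂ :=
    (LinearMap.toMatrixAlgEquiv b : _ →* _).comp X.ρ
  have hA : ∀ g, X.character g = (A g).trace := fun g =>
    LinearMap.trace_eq_matrix_trace ℂ b _
  let P := ∑ h : G, (A h).conjTranspose * A h
  have hP : P.PosDef := by
    have : P = 1 + ∑ h ∈ Finset.univ.erase 1, (A h).conjTranspose * A h := by
      simp only [P]
      rw [← Finset.add_sum_erase _ _ (Finset.mem_univ (1 : G))]
      simp
    rw [this]
    exact Matrix.PosDef.one.add_posSemidef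
      (Matrix.posSemidef_sum _ fun h _ => Matrix.posSemidef_conjTranspose_mul_self (A h))
  have hPu : IsUnit P.det := (Matrix.isUnit_iff_isUnit_det _).mp hP.isUnit
  have hinv : (A g).conjTranspose * P = P * A g⁻¹ := by
    have : (A g).conjTranspose * P * A g = P := by
      simp only [P, Finset.mul_sum, Finset.sum_mul]
      refine Fintype.sum_equiv (Equiv.mulRight g) _ _ fun h => ?_
      simp [Matrix.conjTranspose_mul, Matrix.mul_assoc]
    calc _ = (A g).conjTranspose * P * (A g * A g⁻¹) := by rw [← map_mul]; simp
      _ = _ := by rw [← Matrix.mul_assoc, this]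
  have : A g⁻¹ = P⁻¹ * ((A g).conjTranspose * P) := by
    rw [hinv, Matrix.nonsing_inv_mul_cancel_left _ _ hPu]
  rw [hA, hA, this, Matrix.trace_mul_comm, Matrix.mul_nonsing_inv_cancel_right _ _ hPu,
    Matrix.trace_conjTranspose, starRingEnd_apply]

theorem IntermediateField.algebraMap_restrictRestrictAlgEquivMapHom {k K F E : Type*}
    [Field k] [Field K] [Field F] [Field E]
    [Algebra k K] [Algebra k F] [Algebra k E] [Algebra K E] [Algebra F E]
    [IsScalarTower k K E] [IsScalarTower k F E] [Normal k K] (φ : Gal(E/F)) (x : K) :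
    algebraMap K E (restrictRestrictAlgEquivMapHom k K F E φ x) = φ (algebraMap K E x) :=
  AlgEquiv.restrictNormal_commutes (MulSemiringAction.toAlgAut Gal(E/F) k E φ) K x

theorem IntermediateField.natCard_range_restrictRestrictAlgEquivMapHom {k K F E : Type*}
    [Field k] [Field K] [Field F] [Field E]
    [Algebra k K] [Algebra k F] [Algebra k E] [Algebra K E] [Algebra F E]
    [IsScalarTower k K E] [IsScalarTower k F E] [FiniteDimensional k K] [IsGalois k K]
    [IsGalois F E] (L : IntermediateField k K)
    (hL : ∀ x : K, x ∈ L ↔ algebraMap K E x ∈ Set.range (algebraMap F E)) :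
    Nat.card (restrictRestrictAlgEquivMapHom k K F E).range = finrank L K := by
  have : fixedField (restrictRestrictAlgEquivMapHom k K F E).range = L := by
    ext x
    rw [hL, mem_fixedField_iff]
    have : algebraMap K E x ∈ Set.range (algebraMap F E) ↔
        ∀ φ : Gal(E/F), φ (algebraMap K E x) = algebraMap K E x := by
      exact InfiniteGalois.mem_range_algebraMap_iff_fixed _
    simp [this, ← algebraMap_restrictRestrictAlgEquivMapHom (k := k)]
  rw [← this, ← IsGalois.card_fixingSubgroup_eq_finrank, fixingSubgroup_fixedField]

theorem IntermediateField.restrict_sup_restrict_eq_top {k Ω : Type*} [Field k] [Field Ω]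
    [Algebra k Ω] (K F : IntermediateField k Ω) :
    restrict (le_sup_left : K ≤ K ⊔ F) ⊔ restrict (le_sup_right : F ≤ K ⊔ F) = ⊤ := by
  rw [← lift_inj, lift_sup, lift_restrict, lift_restrict, lift_top]

theorem IntermediateField.isGalois_restrict_sup {k Ω : Type*} [Field k] [Field Ω] [Algebra k Ω]
    (K F : IntermediateField k Ω) [FiniteDimensional k K] [IsGalois k K] :
    IsGalois (restrict (le_sup_right : F ≤ K ⊔ F)) ↥(K ⊔ F) := by
  let e : K ≃ₐ[k] restrict (le_sup_left : K ≤ K ⊔ F) := restrictAlgEquiv _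
  have : IsGalois k (restrict (le_sup_left : K ≤ K ⊔ F)) := .of_algEquiv e
  have : FiniteDimensional k (restrict (le_sup_left : K ≤ K ⊔ F)) :=
    e.toLinearEquiv.finiteDimensional
  exact .sup_right _ _ (restrict_sup_restrict_eq_top K F)

set_option synthInstance.maxHeartbeats 400000 in
theorem IntermediateField.finrank_inclusion_toAlgebra {k Ω : Type*} [Field k] [Field Ω]
    [Algebra k Ω]
    (K F : IntermediateField k Ω) :
    (letI : Algebra ↥(K ⊓ F) ↥K := (IntermediateField.inclusion inf_le_left).toAlgebra
     finrank ↥(K ⊓ F) ↥K) = finrank (restrict (inf_le_left : K ⊓ F ≤ K)) K := by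
  let : Algebra ↥(K ⊓ F) ↥K := (IntermediateField.inclusion inf_le_left).toAlgebra
  refine Algebra.finrank_eq_of_equiv_equiv
    (restrictAlgEquiv (inf_le_left : K ⊓ F ≤ K)).toRingEquiv (RingEquiv.refl K) ?_
  ext x
  rfl

theorem IntermediateField.exists_subgroup_natCard_eq_finrank_inf {k Ω : Type*} [Field k] [Field Ω]
    [Algebra k Ω] (K F : IntermediateField k Ω) [FiniteDimensional k K] [IsGalois k K] :
    ∃ S : Subgroup (K ≃ₐ[k] K),
      Nat.card S = finrank (restrict (inf_le_left : K ⊓ F ≤ K)) K ∧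
      ∀ s ∈ S, ∃ φ : ↥(K ⊔ F) →+* Ω,
        (∀ x (hx : x ∈ K), φ ⟨x, le_sup_left (a := K) hx⟩ = s ⟨x, hx⟩) ∧
        ∀ x (hx : x ∈ F), φ ⟨x, le_sup_right (a := K) hx⟩ = x := by
  let : Algebra K ↥(K ⊔ F) := (IntermediateField.inclusion le_sup_left).toAlgebra
  have : IsScalarTower k K ↥(K ⊔ F) := .of_algebraMap_eq fun _ => rfl
  let F' := restrict (le_sup_right : F ≤ K ⊔ F)
  have : IsGalois F' ↥(K ⊔ F) := isGalois_restrict_sup K F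
  refine ⟨(restrictRestrictAlgEquivMapHom k K F' ↥(K ⊔ F)).range,
    natCard_range_restrictRestrictAlgEquivMapHom _ fun x => ?_, ?_⟩
  · have h1 : algebraMap K ↥(K ⊔ F) x ∈ Set.range (algebraMap F' ↥(K ⊔ F)) ↔ (x : Ω) ∈ F := by
      refine ⟨fun ⟨y, hy⟩ => ?_, fun h => ⟨⟨_, (mem_restrict le_sup_right _).mpr h⟩, rfl⟩⟩
      exact (mem_restrict le_sup_right (algebraMap K ↥(K ⊔ F) x)).mp (hy ▸ y.2)
    rw [h1, mem_restrict, mem_inf]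
    exact and_iff_right x.2
  · rintro _ ⟨φ, rfl⟩
    refine ⟨(K ⊔ F).val.toRingHom.comp (φ : ↥(K ⊔ F) →+* ↥(K ⊔ F)), fun x hx => ?_, fun x hx => ?_⟩
    · exact congrArg Subtype.val (algebraMap_restrictRestrictAlgEquivMapHom (k := k) (K := K)
        φ ⟨x, hx⟩).symm
    · let y : F' := ⟨⟨x, le_sup_right (a := K) hx⟩, (mem_restrict le_sup_right _).mpr hx⟩
      exact congrArg Subtype.val (φ.commutes y)

/-- A `K`-relation over an arbitrary base field `k ⊆ ℂ`: multiplicities in the Galois trace of a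
virtual character with values in `K` are divisible by the degree of `K` over its intersection with the
field of character values. -/
theorem FDRep.exists_int_average_conj_char_mul_sum_algEquiv {k : Type*} [Field k] [Algebra k ℂ]
    (K : IntermediateField k ℂ) [FiniteDimensional k K] [IsGalois k K]
    {G : Type} [Group G] [Fintype G] (V W : FDRep ℂ G) (χρ : G → K)
    (hval : ∀ g, (χρ g : ℂ) = V.character g - W.character g) (θ : G → ℂ)
    (hrel : ∀ g : G, θ g = ∑ σ : K ≃ₐ[k] K, ((σ (χρ g) : K) : ℂ)) (X : FDRep ℂ G) :
    ∃ m : ℤ,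
      (Fintype.card G : ℂ)⁻¹ * (∑ g : G, (starRingEnd ℂ) (X.character g) * θ g) = (m : ℂ) ∧
      (finrank (restrict
        (inf_le_left : K ⊓ IntermediateField.adjoin k (Set.range X.character) ≤ K)) K : ℤ) ∣ m := by
  let F := IntermediateField.adjoin k (Set.range X.character)
  have hF (g : G) : X.character g ∈ F := subset_adjoin _ _ ⟨g, rfl⟩
  have hf (σ : K ≃ₐ[k] K) : ∃ a : ℤ,
      (Fintype.card G : ℂ)⁻¹ * ∑ g : G, X.character g⁻¹ * (σ (χρ g) : ℂ) = a := by
    obtain ⟨τ, hτ⟩ := K.exists_ringHom_extending σ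
    obtain ⟨a, ha⟩ := FDRep.exists_int_average_char_mul_ringHom τ X V
    obtain ⟨b, hb⟩ := FDRep.exists_int_average_char_mul_ringHom τ X W
    refine ⟨a - b, ?_⟩
    have h (g : G) : ((σ (χρ g) : K) : ℂ) = τ (V.character g) - τ (W.character g) := by
      rw [← map_sub, ← hval]
      exact (hτ (χρ g)).symm
    simp_rw [h, mul_sub, Finset.sum_sub_distrib, mul_sub, ha, hb, Int.cast_sub]
  choose f hf using hf
  refine ⟨∑ σ, f σ, ?_, ?_⟩
  · simp_rw [FDRep.conj_character, hrel, Int.cast_sum, ← hf, Finset.mul_sum]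
    exact Finset.sum_comm
  · obtain ⟨S, hS, hS'⟩ := exists_subgroup_natCard_eq_finrank_inf K F
    rw [← hS]
    refine S.natCard_dvd_sum f fun s hs σ => ?_
    obtain ⟨φ, hφK, hφF⟩ := hS' s hs
    have key : (Fintype.card G : ↥(K ⊔ F))⁻¹ * ∑ g : G,
        (⟨X.character g⁻¹, le_sup_right (a := K) (hF g⁻¹)⟩ : ↥(K ⊔ F)) *
          ⟨σ (χρ g), le_sup_left (a := K) (σ (χρ g)).2⟩ = f σ := by
      apply Subtype.val_injective
      simpa using hf σ
    have key' := congrArg φ key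
    simp only [map_mul, map_inv₀, map_natCast, map_sum, map_intCast, hφK _ (σ _).2,
      hφF _ (hF _)] at key'
    exact_mod_cast (hf (s * σ)).symm.trans key'

set_option synthInstance.maxHeartbeats 400000 in
/-- Let `G` be a finite group, `K/ℚ` a finite Galois extension (realized
inside `ℂ`) and `Θ = ∑_i n_i H_i ∈ B(G)` a `K`-relation, i.e.
`⊕_i ℂ[G/H_i]^{⊕n_i} ≅ ⊕_{σ ∈ Gal(K/ℚ)} ρ^σ` for some (virtual) representation `ρ` with
`ℚ(ρ) ⊆ K`.  Then for every complex irreducible representation `χ` of `G`, the multiplicity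
`⟨χ, ℂ[G/Θ]⟩ = (1/|G|) ∑_g conj χ(g) · char_{ℂ[G/Θ]}(g)` is an integer divisible by the
degree `[K : K ∩ ℚ(χ)]`, where `ℚ(χ)` is the field generated by the character values of `χ`.
(Equivalently, in `ℂ[G/Θ] ≅ ⊕_{τ∈Irr_ℚ(G)} N_{ℚ(χ_τ)/ℚ}(χ_τ)^{⊕k_τ}`, each `k_τ` is
divisible by `[K : K ∩ ℚ(χ_τ)]`.) -/
theorem stmt7 (K : IntermediateField ℚ ℂ) [FiniteDimensional ℚ K] [IsGalois ℚ K]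
    {G : Type} [Group G] [Fintype G]
    {ι : Type*} [Fintype ι] (n : ι → ℤ) (H : ι → Subgroup G)
    (V W : FDRep ℂ G) (χρ : G → K)
    (hval : ∀ g, (χρ g : ℂ) = V.character g - W.character g)
    (hrel : ∀ g : G, (∑ i, (n i : ℂ) * (permFix (H i) g : ℂ)) =
      ∑ σ : K ≃ₐ[ℚ] K, ((σ (χρ g) : K) : ℂ))
    (X : FDRep ℂ G) [CategoryTheory.Simple X] :
    ∃ m : ℤ,
      ((Fintype.card G : ℂ))⁻¹ *
          (∑ g : G, (starRingEnd ℂ) (X.character g) *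
            (∑ i, (n i : ℂ) * (permFix (H i) g : ℂ))) = (m : ℂ) ∧
      (letI : Algebra
          ↥(K ⊓ IntermediateField.adjoin ℚ (Set.range X.character))
          ↥K :=
        (IntermediateField.inclusion inf_le_left).toAlgebra
       ((Module.finrank
          ↥(K ⊓ IntermediateField.adjoin ℚ (Set.range X.character)) ↥K : ℤ) ∣ m)) := by
  rw [finrank_inclusion_toAlgebra]
  have : @FiniteDimensional ℚ K _ _ K.algebra'.toModule := ‹_›
  have : @IsGalois ℚ _ K _ K.algebra' := ‹_›
  exact FDRep.exists_int_average_conj_char_mul_sum_algEquiv K V W χρ hval _ hrel X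
end

section
/- Let G = C_n be cyclic, k ∈ ℕ, and α, β ∈ ℚ^×. Define d_{α,β} : B(G) → ℚ^× on subgroups by d_{α,β}(H) = α if k divides [G:H] and β otherwise, extended additively-multiplicatively. If α/β is the norm of an element of ℚ(ζ_k), then for every number field K and every K-relation Θ ∈ B(G), the value d_{α,β}(Θ) lies in N_{K/ℚ}(K^×). -/
open scoped BigOperators

/-- `Θ = ∑_i n_i H_i ∈ B(G)` is a *K-relation*: there is a (virtual) complex representation
`ρ` of `G` whose character values lie in `K` (via an embedding `e : K → ℂ`) such that
`⊕_i ℂ[G/H_i]^{⊕ n_i} ≅ ⊕_{σ ∈ Gal(K/ℚ)} ρ^σ`, expressed as an equality of (virtual)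
characters. -/
def IsKRelation (K : Type*) [Field K] [NumberField K] [IsGalois ℚ K]
    {G : Type} [Group G] {ι : Type*} [Fintype ι]
    (n : ι → ℤ) (H : ι → Subgroup G) : Prop :=
  ∃ (e : K →+* ℂ) (V W : FDRep ℂ G) (χ : G → K),
    (∀ g, e (χ g) = V.character g - W.character g) ∧
    ∀ g : G, (∑ i, (n i : ℂ) * (permFix (H i) g : ℂ)) =
      ∑ σ : K ≃ₐ[ℚ] K, e (σ (χ g))

open Module

/-- The twist of a character by a one-dimensional character has integral average. -/
lemma exists_sum_character_mul_eq {G V : Type*} [Group G] [Fintype G] [AddCommGroup V] [Module ℂ V]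
    [FiniteDimensional ℂ V] (ρ : Representation ℂ G V) (ψ : G →* ℂ) :
    ∃ a : ℕ, ∑ g, ρ.character g * ψ g = Nat.card G * a := by
  have hG : (Nat.card G : ℂ) ≠ 0 := by simp
  let _ : Invertible (Nat.card G : ℂ) := invertibleOfNonzero hG
  let ρ' : Representation ℂ G V :=
    { toFun := fun g ↦ ψ g • ρ g
      map_one' := by simp
      map_mul' := fun g h ↦ by rw [map_mul, map_mul, smul_mul_smul_comm] }
  refine ⟨finrank ℂ ρ'.invariants, ?_⟩
  rw [← Representation.card_inv_mul_sum_char_eq_finrank ρ', mul_inv_cancel_left₀ hG]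
  exact Finset.sum_congr rfl fun g _ ↦ by simp [ρ', Representation.character, mul_comm]

/-- The sum of a function invariant under left translation by a subgroup is divisible by the order
of the subgroup. -/
lemma Subgroup.card_dvd_sum_of_mul_left {G : Type*} [Group G] [Fintype G] (S : Subgroup G)
    (f : G → ℤ) (hf : ∀ h ∈ S, ∀ g, f (h * g) = f g) : (Nat.card S : ℤ) ∣ ∑ g, f g := by
  classical
  let _ : Fintype S := Fintype.ofFinite S
  obtain ⟨T, hT, -⟩ := S.exists_isComplement_right 1
  let _ : Fintype T := Fintype.ofFinite T
  rw [← hT.equiv.symm.sum_comp, Fintype.sum_prod_type_right]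
  refine Finset.dvd_sum fun t _ ↦ ?_
  have key (h : S) : f (hT.equiv.symm (h, t)) = f t := hf _ h.2 _
  simp [key]

/-- The permutation character of `G ⧸ H`, for commutative `G`. -/
lemma permFix_eq {G : Type*} [CommGroup G] (H : Subgroup G) [DecidablePred (· ∈ H)] (g : G) :
    permFix H g = if g ∈ H then H.index else 0 := by
  have key : ∀ x : G ⧸ H, g • x = x ↔ g ∈ H := fun x ↦ by
    induction x using QuotientGroup.induction_on with
    | H x =>
      rw [MulAction.Quotient.smul_coe, eq_comm, QuotientGroup.eq, smul_eq_mul, mul_comm g,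
        inv_mul_cancel_left]
  unfold permFix
  split_ifs with hg
  · simp [key, hg, Subgroup.index]
  · simp [key, hg]

/-- The multiplicity of a one-dimensional character in the permutation representation on `G ⧸ H`
is one if it is trivial on `H`, and zero otherwise. -/
lemma sum_permFix_mul {G : Type*} [CommGroup G] [Fintype G] (H : Subgroup G) {R : Type*}
    [CommRing R] [IsDomain R] (ψ : G →* R) [Decidable (∀ h ∈ H, ψ h = 1)] :
    ∑ g, (permFix H g : R) * ψ g = if ∀ h ∈ H, ψ h = 1 then (Nat.card G : R) else 0 := by
  classical
  have h1 : ∑ g, (permFix H g : R) * ψ g = H.index * ∑ h : H, ψ.comp H.subtype h := by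
    simp only [permFix_eq, Nat.cast_ite, Nat.cast_zero, ite_mul, zero_mul]
    rw [← Finset.sum_filter, Finset.mul_sum]
    exact Finset.sum_subtype _ (by simp) _
  have h2 : ψ.comp H.subtype = 1 ↔ ∀ h ∈ H, ψ h = 1 := by
    simp [MonoidHom.ext_iff]
  rw [h1, sum_hom_units, if_congr h2 rfl rfl]
  split_ifs
  · rw [← Nat.card_eq_fintype_card]
    exact_mod_cast congrArg (Nat.cast (R := R)) H.index_mul_card
  · simp

/-- In a finite cyclic group, a character sending a generator to a primitive `k`-th root of unity is
trivial on `H` if and only if `k` divides the index of `H`. -/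
lemma forall_mem_map_eq_one_iff {G R : Type*} [CommGroup G] [Finite G] [CommMonoid R]
    {g₀ : G} (hg₀ : ∀ x, x ∈ Subgroup.zpowers g₀) {k : ℕ} (ψ : G →* R)
    (hψ : IsPrimitiveRoot (ψ g₀) k) (H : Subgroup G) :
    (∀ h ∈ H, ψ h = 1) ↔ k ∣ H.index := by
  constructor
  · intro h
    rw [← hψ.pow_eq_one_iff_dvd, ← map_pow]
    exact h _ (H.pow_index_mem g₀)
  · intro hk h hh
    obtain ⟨a, rfl⟩ := mem_powers_iff_mem_zpowers.2 (hg₀ h)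
    have ho : orderOf (g₀ : G ⧸ H) = H.index := by
      refine orderOf_eq_card_of_forall_mem_zpowers fun x ↦ ?_
      induction x using QuotientGroup.induction_on with
      | H x =>
        obtain ⟨b, rfl⟩ := hg₀ x
        exact ⟨b, rfl⟩
    simp only [map_pow]
    rw [hψ.pow_eq_one_iff_dvd]
    refine hk.trans ?_
    rw [← ho, orderOf_dvd_iff_pow_eq_one, ← QuotientGroup.mk_pow, QuotientGroup.eq_one_iff]
    exact hh

/-- A relation over `K`, paired with a character `ψ` whose values lie in a subfield `L` of an
algebraic Galois extension `E` of `ℚ`, has multiplicity divisible by `[K : F]`, for some subfield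
`F` of `K` embedding into `L`. -/
lemma exists_finrank_dvd {G : Type*} [Fintype G] {K E : Type*} [Field K] [NumberField K]
    [IsGalois ℚ K] [Field E] [Algebra ℚ E] [IsGalois ℚ E] [Algebra K E] [IsScalarTower ℚ K E]
    (L : IntermediateField ℚ E) (χ : G → K) (ψ : G → E) (hψ : ∀ g, ψ g ∈ L) (c : E) (hc : c ≠ 0)
    (hint : ∀ τ : E ≃ₐ[ℚ] E, ∃ a : ℤ, ∑ g, algebraMap K E (χ g) * τ (ψ g) = c * a)
    (hcQ : ∀ τ : E ≃ₐ[ℚ] E, τ c = c) (N : ℤ)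
    (hN : ∑ g, (∑ σ : K ≃ₐ[ℚ] K, algebraMap K E (σ (χ g))) * ψ g = c * N) :
    ∃ F : IntermediateField ℚ K, (∀ x ∈ F, algebraMap K E x ∈ L) ∧ (finrank F K : ℤ) ∣ N := by
  have : CharZero E := algebraRat.charZero E
  let S : Subgroup (K ≃ₐ[ℚ] K) := L.fixingSubgroup.map (AlgEquiv.restrictNormalHom K)
  have hres : ∀ (τ : E ≃ₐ[ℚ] E) (x : K),
      algebraMap K E (AlgEquiv.restrictNormalHom K τ x) = τ (algebraMap K E x) :=
    fun τ x ↦ τ.restrictNormal_commutes K x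
  have hint' : ∀ σ : K ≃ₐ[ℚ] K, ∃ a : ℤ, ∑ g, algebraMap K E (σ (χ g)) * ψ g = c * a := fun σ ↦ by
    obtain ⟨τ, rfl⟩ := AlgEquiv.restrictNormalHom_surjective (F := ℚ) (K₁ := K) E σ
    obtain ⟨a, ha⟩ := hint τ⁻¹
    refine ⟨a, ?_⟩
    have := congrArg τ ha
    simpa [hres, hcQ, AlgEquiv.aut_inv] using this
  choose a ha using hint'
  refine ⟨IntermediateField.fixedField S, fun x hx ↦ ?_, ?_⟩
  · rw [← InfiniteGalois.fixedField_fixingSubgroup L]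
    intro τ
    have := hx ⟨_, Subgroup.mem_map_of_mem _ τ.2⟩
    exact (hres τ x).symm.trans (congrArg (algebraMap K E) this)
  · have hNa : N = ∑ σ, a σ := by
      have : c * N = c * ((∑ σ, a σ : ℤ) : E) := by
        rw [← hN]
        push_cast
        simp_rw [Finset.mul_sum, ← ha, Finset.sum_mul]
        exact Finset.sum_comm
      exact_mod_cast mul_left_cancel₀ hc this
    rw [IntermediateField.finrank_fixedField_eq_card, hNa]
    refine S.card_dvd_sum_of_mul_left a ?_
    rintro _ ⟨τ, hτ, rfl⟩ σ
    have : c * (a (AlgEquiv.restrictNormalHom K τ * σ) : E) = c * a σ := by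
      have h1 : τ (c * a σ) = c * a σ := by simp [hcQ]
      rw [← ha, ← h1, ← ha, map_sum]
      refine Finset.sum_congr rfl fun g _ ↦ ?_
      rw [map_mul, ← hres, show τ (ψ g) = ψ g from hτ ⟨_, hψ g⟩]
      rfl
    exact_mod_cast mul_left_cancel₀ hc this

/-- If `F ⊆ K` embeds into `L`, then norms from `L` become norms from `K` after raising them to a
multiple of `[K : F]`. -/
lemma exists_zpow_eq_norm {k K L : Type*} [Field k] [Field K] [Field L] [Algebra k K] [Algebra k L]
    [FiniteDimensional k K] [FiniteDimensional k L]
    (F : IntermediateField k K) (f : F →ₐ[k] L) (z : L) (N : ℤ) (hN : (finrank F K : ℤ) ∣ N) :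
    ∃ w : K, Algebra.norm k z ^ N = Algebra.norm k w := by
  let _ : Algebra F L := f.toRingHom.toAlgebra
  have : IsScalarTower k F L := IsScalarTower.of_algHom f
  obtain ⟨b, rfl⟩ := hN
  have hpow : Algebra.norm k (Algebra.norm F z ^ b) = Algebra.norm k (Algebra.norm F z) ^ b :=
    map_zpow₀ (⟨⟨Algebra.norm k, Algebra.norm_zero⟩, map_one _, map_mul _⟩ : F →*₀ k) _ b
  refine ⟨algebraMap F K (Algebra.norm F z ^ b), ?_⟩
  rw [← Algebra.norm_norm (R := k) (S := F) (A := K), Algebra.norm_algebraMap, map_pow, hpow,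
    Algebra.norm_norm, zpow_mul, zpow_natCast, ← zpow_natCast, ← zpow_natCast, ← zpow_mul,
    ← zpow_mul, mul_comm]

/-- For a `K`-relation in a cyclic group, the norms from `ℚ(ζ_k)` become norms from `K` after
raising them to the multiplicity of a character of order `k`. -/
lemma IsKRelation.exists_zpow_eq_norm (n k : ℕ) [NeZero n] [NeZero k]
    {K : Type*} [Field K] [NumberField K] [IsGalois ℚ K]
    {ι : Type*} [Fintype ι] {m : ι → ℤ} {H : ι → Subgroup (Multiplicative (ZMod n))}
    (hΘ : IsKRelation K m H) (z : CyclotomicField k ℚ) :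
    ∃ w : K, Algebra.norm ℚ z ^ (∑ i, if k ∣ (H i).index then m i else 0) =
      Algebra.norm ℚ w := by
  classical
  by_cases hkn : k ∣ n
  swap
  · refine ⟨1, ?_⟩
    have h (i : ι) : ¬ k ∣ (H i).index := fun h ↦
      hkn (h.trans (by simpa using (H i).index_dvd_card))
    simp [h]
  obtain ⟨e, V, W, χ, hχ, hrel⟩ := hΘ
  let E := algebraicClosure ℚ ℂ
  have : IsAlgClosure ℚ E := algebraicClosure.isAlgClosure ℚ ℂ
  have : IsAlgClosed E := IsAlgClosure.isAlgClosed ℚ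
  have : IsGalois ℚ E := IsAlgClosure.isGalois ℚ E
  have : IsCyclotomicExtension {k} ℚ (CyclotomicField k ℚ) :=
    CyclotomicField.isCyclotomicExtension k ℚ
  let e' : K →ₐ[ℚ] E := (e.codRestrict E fun x ↦ mem_algebraicClosure_iff.2
    ((Algebra.IsAlgebraic.isAlgebraic (R := ℚ) x).algHom e.toRatAlgHom)).toRatAlgHom
  let _ : Algebra K E := e'.toRingHom.toAlgebra
  have : IsScalarTower ℚ K E := IsScalarTower.of_algHom e'
  have he (x : K) : (algebraMap K E x : ℂ) = e x := rfl
  let f : CyclotomicField k ℚ →ₐ[ℚ] E := IsAlgClosed.lift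
  have hζ : IsPrimitiveRoot (f (IsCyclotomicExtension.zeta k ℚ (CyclotomicField k ℚ))) k :=
    (IsCyclotomicExtension.zeta_spec k ℚ (CyclotomicField k ℚ)).map_of_injective f.injective
  set ζ := f (IsCyclotomicExtension.zeta k ℚ (CyclotomicField k ℚ))
  let g₀ : Multiplicative (ZMod n) := Multiplicative.ofAdd 1
  have hg₀ : ∀ x, x ∈ Subgroup.zpowers g₀ := fun x ↦ by
    refine ⟨x.toAdd.val, ?_⟩
    simp [g₀, ← ofAdd_zsmul]
  have hord : orderOf (hζ.isUnit (NeZero.ne k)).unit ∣ orderOf g₀ := by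
    rw [orderOf_eq_card_of_forall_mem_zpowers hg₀, ← orderOf_units, IsUnit.unit_spec,
      ← hζ.eq_orderOf]
    simpa using hkn
  let ψ : Multiplicative (ZMod n) →* E :=
    (Units.coeHom E).comp (monoidHomOfForallMemZpowers hg₀ hord)
  have hψ₀ : ψ g₀ = ζ := by simp [ψ]
  obtain ⟨F, hF, hdvd⟩ := exists_finrank_dvd f.fieldRange χ ψ (fun g ↦ by
      obtain ⟨b, rfl⟩ := mem_powers_iff_mem_zpowers.2 (hg₀ g)
      simp only [map_pow, hψ₀]
      exact pow_mem (AlgHom.mem_fieldRange.2 ⟨_, rfl⟩ : ζ ∈ f.fieldRange) b)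
    (n : E) (by simp [NeZero.ne n]) (fun τ ↦ by
      let ψ' : Multiplicative (ZMod n) →* ℂ :=
        (algebraMap E ℂ : E →* ℂ).comp ((τ : E →* E).comp ψ)
      obtain ⟨a, ha⟩ := exists_sum_character_mul_eq V.ρ ψ'
      obtain ⟨b, hb⟩ := exists_sum_character_mul_eq W.ρ ψ'
      refine ⟨a - b, Subtype.val_injective ?_⟩
      have : ∑ g, e (χ g) * ψ' g = n * ((a : ℂ) - b) := by
        simp_rw [hχ, sub_mul, Finset.sum_sub_distrib, mul_sub]
        simpa using! congrArg₂ (· - ·) ha hb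
      simpa [he] using! this) (by simp) (∑ i, if k ∣ (H i).index then m i else 0) (by
      have hrel' : ∀ g, ∑ σ : K ≃ₐ[ℚ] K, algebraMap K E (σ (χ g)) =
          ∑ i, (m i : E) * (permFix (H i) g : E) := fun g ↦
        Subtype.val_injective (by simpa [he] using (hrel g).symm)
      simp_rw [hrel', Finset.sum_mul, mul_assoc]
      rw [Finset.sum_comm]
      simp_rw [← Finset.mul_sum, sum_permFix_mul,
        forall_mem_map_eq_one_iff hg₀ ψ (hψ₀ ▸ hζ)]
      push_cast
      rw [Finset.mul_sum]
      exact Finset.sum_congr rfl fun i _ ↦ by split_ifs <;> simp [mul_comm])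
  let fF : F →ₐ[ℚ] CyclotomicField k ℚ :=
    (AlgEquiv.ofInjectiveField f).symm.toAlgHom.comp
      ((e'.comp F.val).codRestrict f.range fun x ↦ hF x x.2)
  exact _root_.exists_zpow_eq_norm F fF z _ hdvd

/-- Let `G = C_n` be cyclic, `k ∈ ℕ` (with `k ≥ 1`), and `α, β ∈ ℚ^×`.
Define `d_{α,β}` on subgroups of `G` by `d_{α,β}(H) = α` if `k ∣ [G:H]` and `β` otherwise,
extended multiplicatively to the Burnside ring.  If `α/β` is the norm of an element of
`ℚ(ζ_k)`, then for every number field `K` (Galois over `ℚ`) and every `K`-relation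
`Θ = ∑_i n_i H_i ∈ B(G)`, the value `d_{α,β}(Θ) = ∏_i d_{α,β}(H_i)^{n_i}` lies in
`N_{K/ℚ}(K^×)`. -/
theorem stmt8 (n : ℕ) [NeZero n] (k : ℕ+) (α β : ℚ) (hα : α ≠ 0) (hβ : β ≠ 0)
    (hnorm : ∃ z : CyclotomicField k ℚ, α / β = Algebra.norm ℚ z)
    (K : Type*) [Field K] [NumberField K] [IsGalois ℚ K]
    {ι : Type*} [Fintype ι] (m : ι → ℤ)
    (H : ι → Subgroup (Multiplicative (ZMod n)))
    (hΘ : IsKRelation K m H) :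
    ∃ w : K,
      (∏ i, (if (k : ℕ) ∣ (H i).index then α else β) ^ (m i)) = Algebra.norm ℚ w := by
  have : NeZero (k : ℕ) := ⟨k.ne_zero⟩
  obtain ⟨z, hz⟩ := hnorm
  obtain ⟨w₁, hw₁⟩ := hΘ.exists_zpow_eq_norm n k z
  have : IsCyclotomicExtension {1} ℚ (CyclotomicField 1 ℚ) :=
    CyclotomicField.isCyclotomicExtension 1 ℚ
  have hβ' : Algebra.norm ℚ (algebraMap ℚ (CyclotomicField 1 ℚ) β) = β := by
    rw [Algebra.norm_algebraMap, IsCyclotomicExtension.finrank (n := 1) _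
      (Polynomial.cyclotomic.irreducible_rat Nat.one_pos)]
    simp
  obtain ⟨w₂, hw₂⟩ := hΘ.exists_zpow_eq_norm n 1 (algebraMap ℚ (CyclotomicField 1 ℚ) β)
  refine ⟨w₁ * w₂, ?_⟩
  have hprod {x : ℚ} (hx : x ≠ 0) (f : ι → ℤ) : x ^ (∑ i, f i) = ∏ i, x ^ f i := by
    classical
    refine Finset.induction_on Finset.univ (by simp) fun i s hi h ↦ ?_
    rw [Finset.sum_insert hi, Finset.prod_insert hi, zpow_add₀ hx, h]
  rw [map_mul, ← hw₁, ← hw₂, ← hz, hβ', hprod (div_ne_zero hα hβ), hprod hβ,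
    ← Finset.prod_mul_distrib]
  refine Finset.prod_congr rfl fun i _ ↦ ?_
  split_ifs with h h' h'
  · rw [← mul_zpow, div_mul_cancel₀ _ hβ]
  · exact absurd (one_dvd _) h'
  · simp
  · exact absurd (one_dvd _) h'
end

section
/- Let G = C_n be cyclic. The function g : B(G) → ℚ^× defined on subgroups by g(H) = [G : H] satisfies: for every number field K and every K-relation Θ = ∑_i n_i H_i in B(G), the value g(Θ) = ∏_i [G:H_i]^{n_i} is the norm of an element of K. -/
open scoped BigOperators

open Polynomial Module in
/-- If `T ^ n = 1`, the trace of `T ^ j` is the sum of the `j`-th powers of the `n`-th roots of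
unity, weighted by the dimensions of the eigenspaces of `T`. -/
theorem trace_pow_eq_sum_finrank_eigenspace {k V : Type*} [Field k] [IsAlgClosed k] [CharZero k]
    [AddCommGroup V] [Module k V] [FiniteDimensional k V] {n : ℕ} (hn : 0 < n)
    (T : Module.End k V) (hT : T ^ n = 1) (j : ℕ) :
    LinearMap.trace k V (T ^ j) =
      ∑ ζ ∈ nthRootsFinset n (1 : k), (finrank k (T.eigenspace ζ) : k) * ζ ^ j := by
  classical
  have hss : T.IsSemisimple := by
    refine Module.End.isSemisimple_of_squarefree_aeval_eq_zero (p := (X ^ n - 1 : k[X]))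
      ?_ (by simp [hT])
    have : NeZero (n : k) := ⟨by exact_mod_cast hn.ne'⟩
    exact ((separable_X_pow_sub_C (1 : k) NeZero.out one_ne_zero).squarefree)
  have htop : ⨆ μ, T.eigenspace μ = ⊤ :=
    hss.iSup_maxGenEigenspace_eq_top_iff.1 (Module.End.iSup_maxGenEigenspace_eq_top T)
  have hint := DirectSum.isInternal_submodule_of_iSupIndep_of_iSup_eq_top
    T.eigenspaces_iSupIndep htop
  have hmem : ∀ μ, T.eigenspace μ ≠ ⊥ → μ ∈ nthRootsFinset n (1 : k) := by
    intro μ hμ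
    obtain ⟨v, hv, hv0⟩ := Submodule.exists_mem_ne_zero_of_ne_bot hμ
    have h1 : (T ^ n) v = μ ^ n • v := Module.End.HasEigenvector.pow_apply ⟨hv, hv0⟩ n
    rw [hT, Module.End.one_apply] at h1
    rw [mem_nthRootsFinset hn]
    have : (1 - μ ^ n) • v = 0 := by rw [sub_smul, one_smul, ← h1, sub_self]
    have := (smul_eq_zero.1 this).resolve_right hv0
    exact (sub_eq_zero.1 this).symm
  have hfin : {μ | T.eigenspace μ ≠ ⊥}.Finite := (nthRootsFinset n (1 : k)).finite_toSet.subset hmem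
  have hpow : ∀ μ, ∀ v ∈ T.eigenspace μ, (T ^ j) v = μ ^ j • v := by
    intro μ v hv
    rcases eq_or_ne v 0 with rfl | hv0
    · simp
    · exact Module.End.HasEigenvector.pow_apply ⟨hv, hv0⟩ j
  have hmaps : ∀ μ, Set.MapsTo (T ^ j) (T.eigenspace μ) (T.eigenspace μ) := by
    intro μ v hv
    rw [SetLike.mem_coe, hpow μ v hv]
    exact Submodule.smul_mem _ _ hv
  rw [LinearMap.trace_eq_sum_trace_restrict' hint hfin hmaps]
  refine (Finset.sum_subset (s₂ := nthRootsFinset n (1 : k)) ?_ ?_).trans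
    (Finset.sum_congr rfl fun μ _ => ?_)
  · intro μ hμ
    exact hmem μ (by simpa using hμ)
  · intro μ _ hμ
    have : T.eigenspace μ = ⊥ := by simpa using hμ
    have : Subsingleton (T.eigenspace μ) := by rw [this]; infer_instance
    rw [Subsingleton.elim ((T ^ j).restrict (hmaps μ)) 0, map_zero]
  · have : (T ^ j).restrict (hmaps μ) = μ ^ j • (1 : Module.End k (T.eigenspace μ)) := by
      ext v
      exact hpow μ v v.2
    rw [this, map_smul, LinearMap.trace_one, smul_eq_mul, mul_comm]

/-- The coefficients of a power sum over a finite set of distinct elements are determined by its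
values. -/
theorem eq_of_forall_sum_mul_pow_eq {L : Type*} [Field L] (S : Finset L) (a b : L → L)
    (h : ∀ j : ℕ, ∑ ζ ∈ S, a ζ * ζ ^ j = ∑ ζ ∈ S, b ζ * ζ ^ j) :
    ∀ ζ ∈ S, a ζ = b ζ := by
  have hli : LinearIndependent L fun ζ : L => (fun m : Multiplicative ℕ => powersHom L ζ m) :=
    (linearIndependent_monoidHom (Multiplicative ℕ) L).comp (fun ζ => powersHom L ζ)
      (powersHom L).injective
  have h0 := linearIndependent_iff'.1 hli S (fun ζ => a ζ - b ζ) (by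
    ext m
    simp only [Finset.sum_apply, Pi.smul_apply, powersHom_apply, smul_eq_mul, sub_mul,
      Finset.sum_sub_distrib, h, sub_self, Pi.zero_apply])
  exact fun ζ hζ => sub_eq_zero.1 (h0 ζ hζ)

open Polynomial in
theorem sum_nthRootsFinset_pow {L : Type*} [Field L] {μ : L} {k : ℕ} (hk : 0 < k)
    (hμ : IsPrimitiveRoot μ k) (j : ℕ) :
    ∑ ζ ∈ nthRootsFinset k (1 : L), ζ ^ j = if k ∣ j then (k : L) else 0 := by
  split_ifs with hj
  · obtain ⟨l, rfl⟩ := hj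
    rw [Finset.sum_congr rfl (g := fun _ => (1 : L))]
    · simp [hμ.card_nthRootsFinset]
    · intro ζ hζ
      rw [pow_mul, (mem_nthRootsFinset hk 1).1 hζ, one_pow]
  · have hμ0 : μ ≠ 0 := hμ.ne_zero hk.ne'
    have h : μ ^ j * ∑ ζ ∈ nthRootsFinset k (1 : L), ζ ^ j
        = ∑ ζ ∈ nthRootsFinset k (1 : L), ζ ^ j := by
      rw [Finset.mul_sum]
      refine Finset.sum_equiv (Equiv.mulLeft₀ μ hμ0) (fun ζ => ?_) (fun ζ _ => ?_)
      · simp [mem_nthRootsFinset hk, mul_pow, hμ.pow_eq_one]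
      · simp [mul_pow]
    have h1 : μ ^ j ≠ 1 := fun h => hj (hμ.dvd_of_pow_eq_one j h)
    have : (μ ^ j - 1) * ∑ ζ ∈ nthRootsFinset k (1 : L), ζ ^ j = 0 := by
      rw [sub_mul, h, one_mul, sub_self]
    exact (mul_eq_zero.1 this).resolve_left (sub_ne_zero.2 h1)

open Polynomial in
theorem prod_nthRootsFinset_erase_one_sub {L : Type*} [Field L] [DecidableEq L] {μ : L} {k : ℕ}
    (hk : 0 < k) (hμ : IsPrimitiveRoot μ k) :
    ∏ ζ ∈ (nthRootsFinset k (1 : L)).erase 1, (1 - ζ) = k := by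
  have h := X_pow_sub_one_eq_prod hk hμ
  have h1 : (1 : L) ∈ nthRootsFinset k (1 : L) := by simp [mem_nthRootsFinset hk]
  rw [← Finset.mul_prod_erase _ _ h1, C_1, ← mul_geom_sum] at h
  have h2 := mul_left_cancel₀ (by simpa using X_sub_C_ne_zero (1 : L)) h
  have h3 := congrArg (Polynomial.eval 1) h2
  simpa [eval_prod, eval_geom_sum] using h3.symm

/-- The fixed point count on `C_n ⧸ H` at the `j`-th power of the generator. -/
theorem permFix_ofAdd_natCast {n : ℕ} [NeZero n] (H : Subgroup (Multiplicative (ZMod n))) (j : ℕ) :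
    permFix H (Multiplicative.ofAdd (1 : ZMod n) ^ j) = if H.index ∣ j then H.index else 0 := by
  set g : Multiplicative (ZMod n) := Multiplicative.ofAdd (1 : ZMod n)
  have hord : orderOf (g : Multiplicative (ZMod n) ⧸ H) = H.index := by
    refine orderOf_eq_card_of_forall_mem_zpowers fun x => ?_
    induction x using QuotientGroup.induction_on with
    | H x =>
      refine ⟨(x.toAdd.val : ℤ), ?_⟩
      simp only [zpow_natCast, ← QuotientGroup.mk_pow]
      congr 1
      simp only [g, ← ofAdd_nsmul, nsmul_one, ZMod.natCast_zmod_val, ofAdd_toAdd]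
  have hsmul : ∀ x : Multiplicative (ZMod n) ⧸ H, g ^ j • x = x ↔ H.index ∣ j := by
    intro x
    induction x using QuotientGroup.induction_on with
    | H x =>
      rw [← hord, orderOf_dvd_iff_pow_eq_one, ← mul_eq_right (b := (x : _ ⧸ H))]
      rfl
  simp only [permFix, hsmul]
  split_ifs with h
  · exact Nat.card_congr (Equiv.subtypeUnivEquiv fun _ => h)
  · simp only [h, Nat.card_of_isEmpty]

section RootOfUnitySums

open Polynomial

variable {L : Type*} [Field L] {n : ℕ}

theorem RingEquiv.mem_nthRootsFinset_one_iff (τ : L ≃+* L) (hn : 0 < n) (ζ : L) :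
    ζ ∈ nthRootsFinset n (1 : L) ↔ τ ζ ∈ nthRootsFinset n (1 : L) := by
  rw [mem_nthRootsFinset hn, mem_nthRootsFinset hn, ← map_pow, map_eq_one_iff τ τ.injective]

theorem RingEquiv.map_sum_nthRootsFinset (τ : L ≃+* L) (hn : 0 < n) (c : L → ℤ) (j : ℕ) :
    τ (∑ ζ ∈ nthRootsFinset n (1 : L), (c ζ : L) * ζ ^ j) =
      ∑ ζ ∈ nthRootsFinset n (1 : L), (c (τ.symm ζ) : L) * ζ ^ j := by
  rw [map_sum]
  exact Finset.sum_equiv τ.toEquiv (τ.mem_nthRootsFinset_one_iff hn) (by simp)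

theorem RingEquiv.map_prod_nthRootsFinset [DecidableEq L] (τ : L ≃+* L) (hn : 0 < n)
    (c : L → ℤ) :
    τ (∏ ζ ∈ (nthRootsFinset n (1 : L)).erase 1, (1 - ζ) ^ c ζ) =
      ∏ ζ ∈ (nthRootsFinset n (1 : L)).erase 1, (1 - ζ) ^ c (τ.symm ζ) := by
  rw [map_prod]
  refine Finset.prod_equiv τ.toEquiv (fun ζ => ?_) (by simp)
  have := τ.mem_nthRootsFinset_one_iff hn ζ
  simp only [Finset.mem_erase, RingEquiv.toEquiv_eq_coe, EquivLike.coe_coe]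
  rw [← this, Ne, Ne, map_eq_one_iff τ τ.injective]

end RootOfUnitySums

theorem Finset.zpow_sum_of_ne_zero {ι L : Type*} [Field L] (s : Finset ι) (a : ι → ℤ) {x : L}
    (hx : x ≠ 0) : x ^ (∑ i ∈ s, a i) = ∏ i ∈ s, x ^ a i := by
  classical
  induction s using Finset.induction_on with
  | empty => simp
  | insert i s hi ih => rw [Finset.prod_insert hi, Finset.sum_insert hi, zpow_add₀ hx, ih]

open Polynomial in
/-- If `χ` takes values in `K` and the Galois trace of the power sum it represents has
multiplicities `A`, then `∏ (1 - ζ) ^ A ζ` is a norm from `K`. -/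
theorem exists_norm_eq_prod_one_sub {K L : Type*} [Field K] [NumberField K] [IsGalois ℚ K]
    [Field L] [DecidableEq L] [Algebra K L] [CharZero L] [IsGalois K L] [Normal ℚ L]
    {n : ℕ} (hn : 0 < n) (c A : L → ℤ) (χ : ℕ → K)
    (hc : ∀ j, algebraMap K L (χ j) = ∑ ζ ∈ nthRootsFinset n (1 : L), (c ζ : L) * ζ ^ j)
    (hA : ∀ j, ∑ σ : K ≃ₐ[ℚ] K, algebraMap K L (σ (χ j)) =
      ∑ ζ ∈ nthRootsFinset n (1 : L), (A ζ : L) * ζ ^ j) :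
    ∃ w : K, algebraMap ℚ L (Algebra.norm ℚ w) =
      ∏ ζ ∈ (nthRootsFinset n (1 : L)).erase 1, (1 - ζ) ^ A ζ := by
  have hfix : ∏ ζ ∈ (nthRootsFinset n (1 : L)).erase 1, (1 - ζ) ^ c ζ ∈
      Set.range (algebraMap K L) := by
    rw [InfiniteGalois.mem_range_algebraMap_iff_fixed]
    intro τ
    have hτ : ∀ ζ ∈ nthRootsFinset n (1 : L),
        ((c ((τ : L ≃+* L).symm ζ) : ℤ) : L) = (c ζ : L) := by
      refine eq_of_forall_sum_mul_pow_eq _ _ _ fun j => ?_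
      rw [← RingEquiv.map_sum_nthRootsFinset _ hn, ← hc]
      exact τ.commutes _
    refine ((τ : L ≃+* L).map_prod_nthRootsFinset hn c).trans
      (Finset.prod_congr rfl fun ζ hζ => ?_)
    rw [Int.cast_injective (hτ ζ (Finset.mem_of_mem_erase hζ))]
  obtain ⟨w, hw⟩ := hfix
  refine ⟨w, ?_⟩
  let τ : (K ≃ₐ[ℚ] K) → (L ≃+* L) := fun σ => (σ.liftNormal L : L ≃+* L)
  have hτ : ∀ σ x, τ σ (algebraMap K L x) = algebraMap K L (σ x) :=
    fun σ x => σ.liftNormal_commutes L x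
  have hAc : ∀ ζ ∈ nthRootsFinset n (1 : L),
      ((A ζ : ℤ) : L) = ((∑ σ, c ((τ σ).symm ζ) : ℤ) : L) := by
    refine eq_of_forall_sum_mul_pow_eq _ _ _ fun j => ?_
    rw [← hA]
    simp only [Int.cast_sum, Finset.sum_mul]
    rw [Finset.sum_comm]
    refine Finset.sum_congr rfl fun σ _ => ?_
    rw [← RingEquiv.map_sum_nthRootsFinset _ hn, ← hc, hτ]
  rw [IsScalarTower.algebraMap_apply ℚ K L, Algebra.norm_eq_prod_automorphisms, map_prod]
  simp only [← hτ, hw, RingEquiv.map_prod_nthRootsFinset _ hn]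
  rw [Finset.prod_comm]
  refine Finset.prod_congr rfl fun ζ hζ => ?_
  rw [Int.cast_injective (hAc ζ (Finset.mem_of_mem_erase hζ))]
  have h1 : (1 - ζ) ≠ 0 := sub_ne_zero.2 (Finset.ne_of_mem_erase hζ).symm
  exact (Finset.zpow_sum_of_ne_zero _ _ h1).symm

open Polynomial in
theorem nthRootsFinset_eq_image {L M : Type*} [Field L] [Field M] [DecidableEq M] (f : L →+* M)
    {n : ℕ} {μ : L} (hμ : IsPrimitiveRoot μ n) :
    nthRootsFinset n (1 : M) = (nthRootsFinset n (1 : L)).image f := by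
  refine (Finset.eq_of_subset_of_card_le (fun x hx => ?_) ?_).symm
  · obtain ⟨y, hy, rfl⟩ := Finset.mem_image.1 hx
    exact map_mem_nthRootsFinset_one hy f
  · rw [Finset.card_image_of_injective _ f.injective, hμ.card_nthRootsFinset,
      (hμ.map_of_injective f.injective).card_nthRootsFinset]

open Polynomial in
theorem filter_nthRootsFinset_of_dvd {L : Type*} [Field L] {k n : ℕ}
    [DecidablePred fun ζ : L => ζ ^ k = 1] (hn : 0 < n) (hk : k ∣ n) :
    {ζ ∈ nthRootsFinset n (1 : L) | ζ ^ k = 1} = nthRootsFinset k (1 : L) := by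
  ext ζ
  rw [Finset.mem_filter, mem_nthRootsFinset hn, mem_nthRootsFinset (Nat.pos_of_dvd_of_pos hk hn)]
  refine ⟨And.right, fun h => ⟨?_, h⟩⟩
  obtain ⟨l, rfl⟩ := hk
  rw [pow_mul, h, one_pow]

open Polynomial in
/-- Values of characters of a cyclic group as power sums over the roots of unity of a subfield
`L` of `ℂ`. -/
theorem character_pow_eq_sum_finrank_eigenspace {G : Type} [Group G] {L : Type*} [Field L]
    (f : L →+* ℂ) {n : ℕ} (hn : 0 < n) {μ : L} (hμ : IsPrimitiveRoot μ n) {g : G}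
    (hg : g ^ n = 1) (U : FDRep ℂ G) (j : ℕ) :
    U.character (g ^ j) = ∑ ζ ∈ nthRootsFinset n (1 : L),
      (Module.finrank ℂ (Module.End.eigenspace (U.ρ g) (f ζ)) : ℂ) * f ζ ^ j := by
  classical
  rw [FDRep.character, map_pow, trace_pow_eq_sum_finrank_eigenspace hn (U.ρ g)
    (by rw [← map_pow, hg, map_one]) j, nthRootsFinset_eq_image f hμ,
    Finset.sum_image f.injective.injOn]

/-- A `K`-relation `Θ` of a cyclic group satisfies `∏ [G : H_i] ^ n_i = N(w)` for some `w ∈ K`; here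
`L` is an auxiliary algebraic closure of `K`. -/
theorem IsKRelation.exists_norm_eq_prod_index {K : Type*} (L : Type*) [Field K] [NumberField K]
    [IsGalois ℚ K] [Field L] [CharZero L] [Algebra K L] [IsAlgClosure K L] {n : ℕ} [NeZero n]
    {ι : Type*} [Fintype ι] {m : ι → ℤ} {H : ι → Subgroup (Multiplicative (ZMod n))}
    (hΘ : IsKRelation K m H) :
    ∃ w : K, (∏ i, ((H i).index : ℚ) ^ (m i)) = Algebra.norm ℚ w := by
  classical
  obtain ⟨e, V, W, χ, hχ, hsum⟩ := hΘ
  have hn : 0 < n := NeZero.pos n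
  have : IsAlgClosed L := IsAlgClosure.isAlgClosed K
  have : Algebra.IsAlgebraic K L := IsAlgClosure.isAlgebraic
  have : Algebra.IsAlgebraic ℚ L := Algebra.IsAlgebraic.trans ℚ K L
  have : IsAlgClosure ℚ L := ⟨inferInstance, inferInstance⟩
  have : Normal ℚ L := IsAlgClosure.normal ℚ L
  have : NeZero (n : L) := ⟨by exact_mod_cast hn.ne'⟩
  obtain ⟨μ, hμ⟩ := HasEnoughRootsOfUnity.exists_primitiveRoot L n
  obtain ⟨f, hf⟩ : ∃ f : L →+* ℂ, ∀ x, f (algebraMap K L x) = e x := by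
    let := e.toAlgebra
    let f : L →ₐ[K] ℂ := IsAlgClosed.lift
    exact ⟨f, f.commutes⟩
  let g : Multiplicative (ZMod n) := Multiplicative.ofAdd (1 : ZMod n)
  have hgn : g ^ n = 1 := by simp [g, ← ofAdd_nsmul]
  have hchar := character_pow_eq_sum_finrank_eigenspace f hn hμ hgn
  let c : L → ℤ := fun ζ => Module.finrank ℂ (Module.End.eigenspace (V.ρ g) (f ζ)) -
    Module.finrank ℂ (Module.End.eigenspace (W.ρ g) (f ζ))
  let A : L → ℤ := fun ζ => ∑ i, if ζ ^ (H i).index = 1 then m i else 0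
  have hdvd : ∀ i, (H i).index ∣ n := fun i => by
    simpa using (H i).index_dvd_card
  have hpos : ∀ i, 0 < (H i).index := fun i => Nat.pos_of_dvd_of_pos (hdvd i) hn
  have hprim : ∀ i, ∃ ν : L, IsPrimitiveRoot ν (H i).index := fun i => by
    obtain ⟨l, hl⟩ := hdvd i
    exact ⟨μ ^ l, hμ.pow hn (hl.trans (mul_comm _ _))⟩
  obtain ⟨w, hw⟩ := exists_norm_eq_prod_one_sub (K := K) (L := L) hn c A (fun j => χ (g ^ j))
    (fun j => f.injective (by
      simp only [hf, hχ, hchar, map_sum, map_mul, map_pow, map_sub, map_natCast, c, Int.cast_sub,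
        Int.cast_natCast, sub_mul, Finset.sum_sub_distrib]))
    (fun j => f.injective (by
      have h := hsum (g ^ j)
      simp only [map_sum, hf]
      rw [← h]
      simp only [← map_sum]
      have hA : ∑ ζ ∈ Polynomial.nthRootsFinset n (1 : L), (A ζ : L) * ζ ^ j =
          ∑ i, (m i : L) * (permFix (H i) (g ^ j) : L) := by
        simp only [A, Int.cast_sum, Finset.sum_mul]
        rw [Finset.sum_comm]
        refine Finset.sum_congr rfl fun i _ => ?_
        obtain ⟨ν, hν⟩ := hprim i
        rw [permFix_ofAdd_natCast, Nat.cast_ite, Nat.cast_zero,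
          ← sum_nthRootsFinset_pow (hpos i) hν, ← filter_nthRootsFinset_of_dvd hn (hdvd i),
          Finset.sum_filter, Finset.mul_sum]
        refine Finset.sum_congr rfl fun ζ _ => ?_
        split_ifs <;> simp
      rw [hA]
      simp))
  refine ⟨w, (algebraMap ℚ L).injective ?_⟩
  rw [hw, map_prod]
  have hA : ∀ ζ ∈ (Polynomial.nthRootsFinset n (1 : L)).erase 1, (1 - ζ) ^ A ζ =
      ∏ i, if ζ ^ (H i).index = 1 then (1 - ζ) ^ m i else 1 := by
    intro ζ hζ
    rw [Finset.zpow_sum_of_ne_zero _ _ (sub_ne_zero.2 (Finset.ne_of_mem_erase hζ).symm)]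
    refine Finset.prod_congr rfl fun i _ => ?_
    split_ifs <;> simp
  rw [Finset.prod_congr rfl hA, Finset.prod_comm]
  refine Finset.prod_congr rfl fun i _ => ?_
  obtain ⟨ν, hν⟩ := hprim i
  rw [← Finset.prod_filter, Finset.filter_erase, filter_nthRootsFinset_of_dvd hn (hdvd i),
    Finset.prod_zpow, prod_nthRootsFinset_erase_one_sub (hpos i) hν]
  simp

/-- Let `G = C_n` be cyclic.  The function `g : B(G) → ℚ^×` defined on
subgroups by `g(H) = [G : H]` satisfies: for every number field `K` (Galois over `ℚ`) and
every `K`-relation `Θ = ∑_i n_i H_i ∈ B(G)`, the value `g(Θ) = ∏_i [G:H_i]^{n_i}` is the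
norm of an element of `K`. -/
theorem stmt9 (n : ℕ) [NeZero n]
    (K : Type*) [Field K] [NumberField K] [IsGalois ℚ K]
    {ι : Type*} [Fintype ι] (m : ι → ℤ)
    (H : ι → Subgroup (Multiplicative (ZMod n)))
    (hΘ : IsKRelation K m H) :
    ∃ w : K, (∏ i, ((H i).index : ℚ) ^ (m i)) = Algebra.norm ℚ w := by
  exact hΘ.exists_norm_eq_prod_index (AlgebraicClosure K)
end
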